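/- For all real θ, f(θ) = (16/u⁵)·P(u·cos θ). (Proposition 1 of the paper: the reduced trigonometric function f is, up to the positive factor 16/u⁵, the depressed quintic evaluated at u·cos θ.) -/

import Mathlib

/-- The fifth Chebyshev polynomial as a multiple-angle formula. -/
theorem cos_five_mul (θ : ℝ) :
    Real.cos (5 * θ) = 16 * Real.cos θ ^ 5 - 20 * Real.cos θ ^ 3 + 5 * Real.cos θ := by
  rw [show 5 * θ = 2 * θ + 3 * θ by ring, Real.cos_add, Real.cos_two_mul, Real.cos_three_mul,
    Real.sin_two_mul, Real.sin_three_mul]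
  linear_combination
    (-6 * Real.cos θ + 8 * Real.cos θ * (Real.sin θ ^ 2 + 1 - Real.cos θ ^ 2)) *
      Real.sin_sq_add_cos_sq θ

/-- Proposition 1: for all real θ, f(θ) = (16/u⁵)·P(u·cos θ). -/
theorem quintic_trig_identity (m n p q : ℝ) (hm : m < 0)
    (P : ℝ → ℝ) (hP : ∀ t, P t = t^5 + m*t^3 + n*t^2 + p*t + q)
    (u : ℝ) (hu : u = 2 * Real.sqrt (-m) / Real.sqrt 5)
    (α β γ : ℝ) (hα : α = 16*n/u^3) (hβ : β = 16*p/u^4 - 5) (hγ : γ = 16*q/u^5)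
    (f : ℝ → ℝ)
    (hf : ∀ θ, f θ = α * Real.cos θ ^ 2 + β * Real.cos θ + Real.cos (5*θ) + γ) :
    ∀ θ : ℝ, f θ = 16 / u^5 * P (u * Real.cos θ) := by
  have hu0 : u ≠ 0 := by
    have : 0 < Real.sqrt (-m) := Real.sqrt_pos.2 (by linarith)
    rw [hu]
    positivity
  have hmu : m = -(5 / 4) * u ^ 2 := by
    rw [hu, div_pow, mul_pow, Real.sq_sqrt (by linarith), Real.sq_sqrt (by norm_num)]
    ring
  intro θ
  rw [hf, hP, hα, hβ, hγ, cos_five_mul, hmu]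
  field_simp
  ring
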